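/- arXiv:math/0502041 — 2 statements merged into one kernel-verified Lean document; each statement's English description precedes it below -/
import Mathlib

section
/- For any partition $\lambda$, the Jacobi-Trudi determinant in complete homogeneous symmetric functions equals the dual Jacobi-Trudi determinant in elementary symmetric functions: $\det(h_{\lambda_i - i + j})_{1\le i,j\le l} = \det(e_{\lambda'_i - i + j})_{1\le i,j\le l'}$, where $\lambda'$ is the conjugate partition, $l \ge l(\lambda)$, and $l' \ge l(\lambda')$. -/
/-!
STATEMENT 1: Jacobi-Trudi determinant in complete homogeneous symmetric
functions equals the dual determinant in elementary symmetric functions,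
for any partition `λ`, any `l ≥ l(λ)` and `l' ≥ l(λ')`.
-/

open MvPolynomial

/-- Complete homogeneous symmetric polynomials, extended by `0` to negative indices. -/
noncomputable def hsymmZ (σ : Type*) [Fintype σ] [DecidableEq σ] (k : ℤ) :
    MvPolynomial σ ℤ :=
  if 0 ≤ k then hsymm σ ℤ k.toNat else 0

/-- Elementary symmetric polynomials, extended by `0` to negative indices. -/
noncomputable def esymmZ (σ : Type*) [Fintype σ] [DecidableEq σ] (k : ℤ) :
    MvPolynomial σ ℤ :=
  if 0 ≤ k then esymm σ ℤ k.toNat else 0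

/-- The conjugate partition: `λ'_j` is the number of indices `i` with `λ_i > j`
(partitions are recorded as antitone, eventually-zero functions `ℕ → ℕ`,
0-indexed). -/
noncomputable def conjPart (lam : ℕ → ℕ) : ℕ → ℕ :=
  fun j => Nat.card {i : ℕ | j < lam i}

section JTHelpers

open Finset

theorem jt_hser (σ : Type*) [Fintype σ] [DecidableEq σ] :
    PowerSeries.mk (fun n => hsymm σ ℤ n) =
      ∏ i : σ, PowerSeries.mk (fun n => (X i : MvPolynomial σ ℤ) ^ n) := by
  ext1 n
  rw [PowerSeries.coeff_prod, PowerSeries.coeff_mk, hsymm]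
  simp only [PowerSeries.coeff_mk]
  refine Finset.sum_bij (fun s _ => Multiset.toFinsupp s.1) ?_ ?_ ?_ ?_
  · intro s _
    simp only [mem_finsuppAntidiag, subset_univ, and_true]
    exact (Multiset.sum_count_eq_card (s := univ) (m := s.val) (by simp)).trans s.2
  · intro s _ t _ h
    exact Subtype.ext (Multiset.toFinsupp.injective h)
  · intro f hf
    simp only [mem_finsuppAntidiag, subset_univ, and_true] at hf
    refine ⟨⟨Finsupp.toMultiset f, ?_⟩, mem_univ _, ?_⟩
    · rw [Finsupp.card_toMultiset, Finsupp.sum_fintype _ _ (by simp)]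
      exact hf
    · simp
  · intro s _
    simp only [Multiset.toFinsupp_apply]
    rw [Finset.prod_multiset_map_count]
    refine Finset.prod_subset (subset_univ _) ?_
    intro x _ hx
    rw [Multiset.count_eq_zero_of_notMem (by simpa using hx), pow_zero]

theorem jt_eser (σ : Type*) [Fintype σ] [DecidableEq σ] :
    PowerSeries.mk (fun n => (-1) ^ n * esymm σ ℤ n) =
      ∏ i : σ, (1 - PowerSeries.C (X i : MvPolynomial σ ℤ) * PowerSeries.X) := by
  ext1 n
  simp only [sub_eq_add_neg]
  rw [Finset.prod_one_add, map_sum, PowerSeries.coeff_mk, esymm, Finset.mul_sum]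
  have key : ∀ t : Finset σ, (PowerSeries.coeff n)
      (∏ i ∈ t, -(PowerSeries.C (X i : MvPolynomial σ ℤ) * PowerSeries.X)) =
      if #t = n then (-1) ^ n * ∏ i ∈ t, X i else 0 := by
    intro t
    have : ∏ i ∈ t, -(PowerSeries.C (X i : MvPolynomial σ ℤ) * PowerSeries.X) =
      PowerSeries.C ((-1) ^ #t * ∏ i ∈ t, X i) * PowerSeries.X ^ #t := by
      rw [Finset.prod_neg, Finset.prod_mul_distrib, Finset.prod_const]
      simp [mul_assoc]
    rw [this, PowerSeries.coeff_C_mul, PowerSeries.coeff_X_pow]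
    by_cases h : #t = n
    · simp [h]
    · simp [h, Ne.symm h]
  simp only [key]
  rw [← Finset.sum_filter]
  refine Finset.sum_congr ?_ fun _ _ => rfl
  ext t
  simp [mem_powersetCard]

theorem jt_mul (σ : Type*) [Fintype σ] [DecidableEq σ] :
    PowerSeries.mk (fun n => hsymm σ ℤ n) *
      PowerSeries.mk (fun n => (-1) ^ n * esymm σ ℤ n) = 1 := by
  rw [jt_hser, jt_eser, ← Finset.prod_mul_distrib]
  refine Finset.prod_eq_one fun i _ => ?_
  ext1 n
  rw [mul_sub, mul_one, ← mul_assoc, map_sub]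
  cases n with
  | zero => simp
  | succ n =>
    rw [PowerSeries.coeff_succ_mul_X, PowerSeries.coeff_mul_C]
    simp [PowerSeries.coeff_one, pow_succ]

/-- Lower triangular Toeplitz matrix of a power series. -/
noncomputable def jtToep {R : Type*} [CommRing R] (N : ℕ) (f : PowerSeries R) :
    Matrix (Fin N) (Fin N) R :=
  Matrix.of fun a b => if (b : ℕ) ≤ a then PowerSeries.coeff ((a : ℕ) - b) f else 0

theorem jtToep_mul {R : Type*} [CommRing R] (N : ℕ) (f g : PowerSeries R) :
    jtToep N f * jtToep N g = jtToep N (f * g) := by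
  ext a c
  simp only [jtToep, Matrix.mul_apply, Matrix.of_apply]
  rw [Fin.sum_univ_eq_sum_range (fun b =>
    (if b ≤ (a : ℕ) then PowerSeries.coeff ((a : ℕ) - b) f else 0) *
    (if (c : ℕ) ≤ b then PowerSeries.coeff (b - (c : ℕ)) g else 0)) N]
  split_ifs with h
  · rw [PowerSeries.coeff_mul]
    symm
    refine Finset.sum_of_injOn (fun p => (c : ℕ) + p.2) ?_ ?_ ?_ ?_
    · rintro ⟨p, q⟩ hp ⟨p', q'⟩ hp' h
      simp at hp hp' h ⊢
      omega
    · rintro ⟨p, q⟩ hp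
      have := a.2
      simp at hp ⊢
      omega
    · intro b hb hb'
      by_cases h1 : b ≤ (a : ℕ)
      · by_cases h2 : (c : ℕ) ≤ b
        · exfalso
          apply hb'
          refine ⟨((a : ℕ) - b, b - c), ?_, ?_⟩
          · simp
            omega
          · simp
            omega
        · simp [h2]
      · simp [h1]
    · rintro ⟨p, q⟩ hp
      simp at hp
      have h1 : (c : ℕ) + q ≤ a := by omega
      have h2 : (a : ℕ) - (c + q) = p := by omega
      simp [h1, h2]
  · refine Finset.sum_eq_zero fun b _ => ?_
    by_cases h1 : b ≤ (a : ℕ)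
    · have : ¬ (c : ℕ) ≤ b := by omega
      simp [this]
    · simp [h1]

theorem jtToep_one {R : Type*} [CommRing R] (N : ℕ) :
    jtToep N (1 : PowerSeries R) = 1 := by
  ext a b
  simp only [jtToep, Matrix.of_apply, PowerSeries.coeff_one, Matrix.one_apply, Fin.ext_iff]
  split_ifs <;> first | rfl | omega

theorem jtToep_det {R : Type*} [CommRing R] (N : ℕ) (f : PowerSeries R)
    (hf : PowerSeries.coeff 0 f = 1) : (jtToep N f).det = 1 := by
  rw [Matrix.det_of_lowerTriangular]
  · simp [jtToep, hf]
  · intro i j hij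
    have : i < j := hij
    simp only [jtToep, Matrix.of_apply]
    rw [if_neg]
    rw [Fin.lt_def] at this
    omega

theorem jt_conj (lam : ℕ → ℕ) (hanti : Antitone lam) (l : ℕ)
    (hl : ∀ i, l ≤ i → lam i = 0) (i j : ℕ) : j < lam i ↔ i < conjPart lam j := by
  have hex : ∃ i, lam i ≤ j := ⟨l, by simp [hl l le_rfl]⟩
  have hset : {i : ℕ | j < lam i} = Set.Iio (Nat.find hex) := by
    ext i
    simp only [Set.mem_setOf_eq, Set.mem_Iio, Nat.lt_find_iff, not_le]
    exact ⟨fun h m hm => lt_of_lt_of_le h (hanti hm), fun h => h i le_rfl⟩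
  have hc : conjPart lam j = Nat.find hex := by
    rw [conjPart, hset]
    simp
  rw [hc]
  exact Set.ext_iff.mp hset i

/-- The Grassmannian permutation attached to a partition, as a function. -/
def jtW (l : ℕ) (p q : ℕ → ℕ) (k : ℕ) : ℕ :=
  if k < l then k + p (l - 1 - k) else k - q (k - l)

theorem jtW_lt (l l' : ℕ) (p q : ℕ → ℕ) (hp' : ∀ i, p i ≤ l') (k : ℕ)
    (hk : k < l + l') : jtW l p q k < l + l' := by
  unfold jtW
  have := hp' (l - 1 - k)
  split_ifs <;> omega

theorem jtW_same (l : ℕ) (p q : ℕ → ℕ) (hp : Antitone p) (hq : Antitone q)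
    (hq' : ∀ i, q i ≤ l) (a b : ℕ) (hab : a < b) (h : b < l ∨ l ≤ a) :
    jtW l p q a < jtW l p q b := by
  unfold jtW
  rcases h with h | h
  · have := @hp (l - 1 - b) (l - 1 - a) (by omega)
    rw [if_pos h, if_pos (by omega)]
    omega
  · have := @hq (a - l) (b - l) (by omega)
    have := hq' (a - l)
    rw [if_neg (by omega), if_neg (by omega)]
    omega

theorem jtW_cross (l : ℕ) (p q : ℕ → ℕ) (hpq : ∀ i j, j < p i ↔ i < q j)
    (hq' : ∀ i, q i ≤ l) (a j : ℕ) (ha : a < l) :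
    (l - 1 - a < q j → jtW l p q (l + j) < jtW l p q a) ∧
    (¬ l - 1 - a < q j → jtW l p q a < jtW l p q (l + j)) := by
  unfold jtW
  have h1 := hpq (l - 1 - a) j
  have h2 := hq' j
  rw [if_pos ha, if_neg (by omega), Nat.add_sub_cancel_left]
  constructor <;> intro h <;> omega

theorem jtW_inj (l l' : ℕ) (p q : ℕ → ℕ) (hp : Antitone p) (hq : Antitone q)
    (hpq : ∀ i j, j < p i ↔ i < q j) (hq' : ∀ i, q i ≤ l) (hp' : ∀ i, p i ≤ l') :
    Function.Injective (fun k : Fin (l + l') =>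
      (⟨jtW l p q k, jtW_lt l l' p q hp' k k.2⟩ : Fin (l + l'))) := by
  have key : ∀ a b : ℕ, a < b → jtW l p q a ≠ jtW l p q b := by
    intro a b hab
    by_cases h : b < l ∨ l ≤ a
    · exact (jtW_same l p q hp hq hq' a b hab h).ne
    · push Not at h
      obtain ⟨j, rfl⟩ := Nat.exists_eq_add_of_le h.1
      have := jtW_cross l p q hpq hq' a j h.2
      by_cases h3 : l - 1 - a < q j
      · exact (this.1 h3).ne'
      · exact (this.2 h3).ne
  intro a b hab
  simp only [Fin.mk.injEq] at hab
  rcases lt_trichotomy (a : ℕ) b with h | h | h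
  · exact absurd hab (key _ _ h)
  · exact Fin.ext h
  · exact absurd hab.symm (key _ _ h)

/-- The Grassmannian permutation attached to a partition. -/
noncomputable def jtPerm (l l' : ℕ) (p q : ℕ → ℕ) (hp : Antitone p) (hq : Antitone q)
    (hpq : ∀ i j, j < p i ↔ i < q j) (hq' : ∀ i, q i ≤ l) (hp' : ∀ i, p i ≤ l') :
    Equiv.Perm (Fin (l + l')) :=
  Equiv.ofBijective _ (Finite.injective_iff_bijective.mp (jtW_inj l l' p q hp hq hpq hq' hp'))

theorem jtPerm_coe (l l' : ℕ) (p q : ℕ → ℕ) (hp : Antitone p) (hq : Antitone q)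
    (hpq : ∀ i j, j < p i ↔ i < q j) (hq' : ∀ i, q i ≤ l) (hp' : ∀ i, p i ≤ l')
    (k : Fin (l + l')) : (jtPerm l l' p q hp hq hpq hq' hp' k : ℕ) = jtW l p q k := rfl

theorem jtPerm_sign (l l' : ℕ) (p q : ℕ → ℕ) (hp : Antitone p) (hq : Antitone q)
    (hpq : ∀ i j, j < p i ↔ i < q j) (hq' : ∀ i, q i ≤ l) (hp' : ∀ i, p i ≤ l') :
    (jtPerm l l' p q hp hq hpq hq' hp').sign = ∏ j : Fin l', (-1) ^ q j := by
  rw [Equiv.Perm.sign_eq_prod_prod_Iio, Fin.prod_univ_add]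
  simp only [Fin.lt_def, jtPerm_coe]
  rw [Finset.prod_eq_one, one_mul]
  · refine Finset.prod_congr rfl fun j _ => ?_
    rw [Finset.prod_ite, Finset.prod_const_one, one_mul, Finset.prod_const]
    congr 1
    refine Eq.trans ?_ (Finset.card_range (q j))
    refine Finset.card_bij (fun a _ => l - 1 - (a : ℕ)) ?_ ?_ ?_
    · intro a ha
      simp only [mem_filter, Finset.mem_Iio, Fin.lt_def, Fin.val_natAdd] at ha
      have hal : (a : ℕ) < l := by
        by_contra h
        exact ha.2 (jtW_same l p q hp hq hq' _ _ ha.1 (Or.inr (by omega)))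
      rw [Finset.mem_range]
      by_contra h
      exact ha.2 ((jtW_cross l p q hpq hq' a j hal).2 h)
    · intro a ha b hb hab
      simp only [mem_filter, Finset.mem_Iio, Fin.lt_def, Fin.val_natAdd] at ha hb
      have hal : (a : ℕ) < l := by
        by_contra h
        exact ha.2 (jtW_same l p q hp hq hq' _ _ ha.1 (Or.inr (by omega)))
      have hbl : (b : ℕ) < l := by
        by_contra h
        exact hb.2 (jtW_same l p q hp hq hq' _ _ hb.1 (Or.inr (by omega)))
      apply Fin.ext
      omega
    · intro i hi
      rw [Finset.mem_range] at hi
      have h2 := hq' j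
      refine ⟨⟨l - 1 - i, by omega⟩, ?_, ?_⟩
      · simp only [mem_filter, Finset.mem_Iio, Fin.lt_def, Fin.val_natAdd]
        refine ⟨by omega, ?_⟩
        exact ((jtW_cross l p q hpq hq' (l - 1 - i) j (by omega)).1 (by omega)).not_gt
      · simp only
        omega
  · intro b _
    refine Finset.prod_eq_one fun a ha => ?_
    rw [Finset.mem_Iio, Fin.lt_def] at ha
    rw [if_pos (jtW_same l p q hp hq hq' _ _ ha (Or.inl b.2))]

/-- Complementary minors of a matrix and its inverse. -/
theorem jt_minor {R m n : Type*} [CommRing R] [Fintype m] [Fintype n] [DecidableEq m]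
    [DecidableEq n] (M M' : Matrix (m ⊕ n) (m ⊕ n) R) (h : M * M' = 1) :
    M.toBlocks₁₁.det = M.det * M'.toBlocks₂₂.det := by
  have h1 : M * Matrix.fromBlocks 1 M'.toBlocks₁₂ 0 M'.toBlocks₂₂ =
      Matrix.fromBlocks M.toBlocks₁₁ 0 M.toBlocks₂₁ 1 := by
    rw [← Matrix.fromBlocks_toBlocks M, ← Matrix.fromBlocks_toBlocks M',
      Matrix.fromBlocks_multiply, ← Matrix.fromBlocks_one, Matrix.fromBlocks_inj] at h
    conv_lhs => rw [← Matrix.fromBlocks_toBlocks M]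
    rw [Matrix.fromBlocks_multiply, h.2.1, h.2.2.2]
    simp
  have h2 := congrArg Matrix.det h1
  rw [Matrix.det_mul, Matrix.det_fromBlocks_zero₂₁, Matrix.det_fromBlocks_zero₁₂] at h2
  simpa using h2.symm

end JTHelpers

theorem jacobi_trudi_duality
    (σ : Type*) [Fintype σ] [DecidableEq σ]
    (lam : ℕ → ℕ) (hanti : Antitone lam)
    (l l' : ℕ)
    (hl : ∀ i, l ≤ i → lam i = 0)
    (hl' : ∀ i, l' ≤ i → conjPart lam i = 0) :
    Matrix.det (Matrix.of fun i j : Fin l =>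
        hsymmZ σ ((lam i : ℤ) - i + j)) =
    Matrix.det (Matrix.of fun i j : Fin l' =>
        esymmZ σ ((conjPart lam i : ℤ) - i + j)) := by
  have hpq := jt_conj lam hanti l hl
  have hq : Antitone (conjPart lam) := by
    intro a b hab
    by_contra h
    push Not at h
    have h1 := (hpq _ _).mpr h
    exact lt_irrefl _ ((hpq _ _).mp (lt_of_le_of_lt hab h1))
  have hq' : ∀ j, conjPart lam j ≤ l := by
    intro j
    by_contra h
    push Not at h
    have h1 := (hpq _ _).mpr h
    rw [hl l le_rfl] at h1
    omega
  have hp' : ∀ i, lam i ≤ l' := by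
    intro i
    by_contra h
    push Not at h
    have h1 := (hpq _ _).mp h
    rw [hl' l' le_rfl] at h1
    omega
  set w := jtPerm l l' lam (conjPart lam) hanti hq hpq hq' hp' with hw
  set f := PowerSeries.mk (fun n => hsymm σ ℤ n) with hf
  set g := PowerSeries.mk (fun n => (-1) ^ n * esymm σ ℤ n) with hg
  have hHE : jtToep (l + l') f * jtToep (l + l') g = 1 := by
    rw [jtToep_mul, hf, hg, jt_mul, jtToep_one]
  let M := ((jtToep (l + l') f).submatrix w id).submatrix
    (finSumFinEquiv (m := l) (n := l')) (finSumFinEquiv (m := l) (n := l'))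
  let M' := ((jtToep (l + l') g).submatrix id w).submatrix
    (finSumFinEquiv (m := l) (n := l')) (finSumFinEquiv (m := l) (n := l'))
  have hMM : M * M' = 1 := by
    simp only [M, M']
    rw [Matrix.submatrix_mul_equiv]
    have : (jtToep (l + l') f).submatrix w id * (jtToep (l + l') g).submatrix id w = 1 := by
      have h := Matrix.submatrix_mul_equiv (jtToep (l + l') f) (jtToep (l + l') g) w
        (Equiv.refl _) w
      rw [hHE, Matrix.submatrix_one_equiv] at h
      exact h
    rw [this, Matrix.submatrix_one_equiv]
  have hmin := jt_minor M M' hMM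
  have hdet : M.det = ∏ j : Fin l', (-1) ^ conjPart lam j := by
    simp only [M]
    rw [Matrix.det_submatrix_equiv_self, Matrix.det_permute, jtToep_det _ _ (by simp [hf]),
      hw, jtPerm_sign]
    simp
  have hA : M.toBlocks₁₁.det = Matrix.det (Matrix.of fun i j : Fin l =>
        hsymmZ σ ((lam i : ℤ) - i + j)) := by
    rw [← Matrix.det_submatrix_equiv_self Fin.revPerm]
    congr 1
    ext1 i j
    simp only [Matrix.toBlocks₁₁, M, Matrix.submatrix_apply, Matrix.of_apply, jtToep,
      finSumFinEquiv_apply_left, Fin.revPerm_apply, id, hw, jtPerm_coe, Fin.val_castAdd,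
      Fin.val_rev, jtW, hsymmZ, hf, PowerSeries.coeff_mk]
    have hi := i.2
    have hj := j.2
    have e1 : l - 1 - (l - ((i : ℕ) + 1)) = i := by omega
    rw [if_pos (by omega : l - ((i : ℕ) + 1) < l), e1]
    by_cases h : l - ((j : ℕ) + 1) ≤ l - ((i : ℕ) + 1) + lam i
    · rw [if_pos h, if_pos (by omega)]
      congr 1
      omega
    · rw [if_neg h, if_neg (by omega)]
  have hD : M'.toBlocks₂₂.det = (∏ j : Fin l', (-1) ^ conjPart lam j) *
      Matrix.det (Matrix.of fun i j : Fin l' =>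
        esymmZ σ ((conjPart lam i : ℤ) - i + j)) := by
    have h1 : ∀ B : Matrix (Fin l') (Fin l') (MvPolynomial σ ℤ),
        (Matrix.of fun i j : Fin l' => (-1) ^ (j : ℕ) *
          (Matrix.of fun i j : Fin l' => ((-1) ^ (i : ℕ) * (-1) ^ conjPart lam i) * B i j) i j).det
        = (∏ j : Fin l', (-1) ^ conjPart lam j) * B.det := by
      intro B
      rw [Matrix.det_mul_row, Matrix.det_mul_column, Finset.prod_mul_distrib, ← mul_assoc,
        ← mul_assoc, ← Finset.prod_mul_distrib]
      congr 1
      rw [Finset.prod_eq_one, one_mul]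
      intro i _
      rw [← mul_pow]
      simp
    rw [← h1, ← Matrix.det_transpose]
    congr 1
    ext1 i j
    have hi := i.2
    have hj := j.2
    have hc := hq' i
    simp only [Matrix.toBlocks₂₂, M', Matrix.submatrix_apply, Matrix.of_apply, jtToep,
      Matrix.transpose_apply,
      finSumFinEquiv_apply_right, id, hw, jtPerm_coe, Fin.val_natAdd,
      jtW, esymmZ, hg, PowerSeries.coeff_mk]
    rw [if_neg (by omega : ¬ l + (i : ℕ) < l), Nat.add_sub_cancel_left]
    by_cases h : l + (i : ℕ) - conjPart lam i ≤ l + j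
    · rw [if_pos h, if_pos (by omega), ← mul_assoc]
      have e1 : l + (j : ℕ) - (l + i - conjPart lam i) =
        ((conjPart lam i : ℤ) - i + j).toNat := by omega
      rw [e1]
      congr 1
      rw [← pow_add, ← pow_add]
      have e2 : (j : ℕ) + (i + conjPart lam i) =
        ((conjPart lam i : ℤ) - i + j).toNat + 2 * i := by omega
      rw [e2, pow_add, pow_mul]
      simp
    · rw [if_neg h, if_neg (by omega)]
      simp
  rw [← hA, hmin, hdet, hD, ← mul_assoc, ← Finset.prod_mul_distrib, Finset.prod_eq_one, one_mul]
  intro i _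
  rw [← mul_pow]
  simp
end

section
/- More generally, for any skew diagram $\lambda/\mu$ (partitions with $\mu \subseteq \lambda$), $\det(h_{\lambda_i - \mu_j - i + j})_{1\le i,j\le l} = \det(e_{\lambda'_i - \mu'_j - i + j})_{1\le i,j\le l'}$, where $l \ge l(\lambda), l(\mu)$ and $l' \ge l(\lambda'), l(\mu')$. -/
/-!
STATEMENT 2: Skew Jacobi-Trudi duality:
`det(h_{λ_i - μ_j - i + j}) = det(e_{λ'_i - μ'_j - i + j})` for any skew
diagram `λ/μ`, with matrix sizes `l ≥ l(λ), l(μ)` and `l' ≥ l(λ'), l(μ')`.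
-/

open MvPolynomial

lemma coeff_prod_E (σ : Type*) [Fintype σ] [DecidableEq σ] (n : ℕ) :
    PowerSeries.coeff n (∏ i : σ, (1 + (-(PowerSeries.C (X i : MvPolynomial σ ℤ) * PowerSeries.X)))) =
      (-1) ^ n * esymm σ ℤ n := by
  rw [Finset.prod_one_add, map_sum, esymm, Finset.mul_sum, Finset.powersetCard_eq_filter,
    Finset.sum_filter]
  refine Finset.sum_congr rfl fun t _ => ?_
  rw [Finset.prod_neg, Finset.prod_mul_distrib, Finset.prod_const, ← map_prod]
  have : ((-1 : PowerSeries (MvPolynomial σ ℤ)) ^ t.card) = PowerSeries.C ((-1) ^ t.card) := by simp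
  rw [this, ← mul_assoc, ← map_mul, PowerSeries.coeff_C_mul, PowerSeries.coeff_X_pow]
  split_ifs with h1 h2 h2
  · rw [h1, mul_one]
  · exact absurd h1.symm h2
  · exact absurd h2.symm h1
  · simp

lemma coeff_prod_H (σ : Type*) [Fintype σ] [DecidableEq σ] (n : ℕ) :
    PowerSeries.coeff n (∏ i : σ, PowerSeries.mk (fun k => (X i : MvPolynomial σ ℤ) ^ k)) =
      hsymm σ ℤ n := by
  rw [PowerSeries.coeff_prod, hsymm]
  simp only [PowerSeries.coeff_mk]
  symm
  refine Finset.sum_bij (fun s _ => Multiset.toFinsupp s.1) ?_ ?_ ?_ ?_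
  · intro s _
    simp only [Finset.mem_finsuppAntidiag, Finset.subset_univ, and_true]
    have := Multiset.sum_count_eq_card (s := Finset.univ) (m := s.1) (by simp)
    exact this.trans s.2
  · intro a _ b _ h
    exact Subtype.ext (Multiset.toFinsupp.injective h)
  · intro f hf
    refine ⟨⟨Finsupp.toMultiset f, ?_⟩, Finset.mem_univ _, by simp⟩
    simp only [Finset.mem_finsuppAntidiag, Finset.subset_univ, and_true] at hf
    rw [Finsupp.card_toMultiset, Finsupp.sum_fintype _ _ (by simp)]
    exact hf
  · intro s _
    rw [Finset.prod_multiset_map_count]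
    refine Finset.prod_subset (Finset.subset_univ _) ?_
    intro i _ hi
    rw [Multiset.count_eq_zero_of_notMem (by simpa using hi), pow_zero]

lemma geom_mul {R : Type*} [CommRing R] (x : R) :
    PowerSeries.mk (fun k => x ^ k) * (1 + (-(PowerSeries.C x * PowerSeries.X))) = 1 := by
  ext n
  rw [mul_add, mul_one, mul_neg, mul_comm (PowerSeries.C x), ← mul_assoc]
  cases n with
  | zero => simp
  | succ n => 
    simp [PowerSeries.coeff_succ_mul_X, PowerSeries.coeff_one, pow_succ]

lemma sum_HE (σ : Type*) [Fintype σ] [DecidableEq σ] (n : ℕ) :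
    ∑ p ∈ Finset.HasAntidiagonal.antidiagonal n, hsymm σ ℤ p.1 * ((-1) ^ p.2 * esymm σ ℤ p.2) =
      if n = 0 then 1 else 0 := by
  have h : (∏ i : σ, PowerSeries.mk (fun k => (X i : MvPolynomial σ ℤ) ^ k)) *
      (∏ i : σ, (1 + (-(PowerSeries.C (X i : MvPolynomial σ ℤ) * PowerSeries.X)))) = 1 := by
    rw [← Finset.prod_mul_distrib]
    exact Finset.prod_eq_one fun i _ => geom_mul _
  have := congrArg (PowerSeries.coeff n) h
  rw [PowerSeries.coeff_mul, PowerSeries.coeff_one] at this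
  simpa only [coeff_prod_E, coeff_prod_H] using this

lemma hsymmZ_natCast (σ : Type*) [Fintype σ] [DecidableEq σ] (n : ℕ) :
    hsymmZ σ (n : ℤ) = hsymm σ ℤ n := by simp [hsymmZ]

lemma esymmZ_natCast (σ : Type*) [Fintype σ] [DecidableEq σ] (n : ℕ) :
    esymmZ σ (n : ℤ) = esymm σ ℤ n := by simp [esymmZ]

lemma hsymmZ_neg (σ : Type*) [Fintype σ] [DecidableEq σ] (k : ℤ) (h : k < 0) :
    hsymmZ σ k = 0 := by simp [hsymmZ, h]

lemma esymmZ_neg (σ : Type*) [Fintype σ] [DecidableEq σ] (k : ℤ) (h : k < 0) :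
    esymmZ σ k = 0 := by simp [esymmZ, h]

/-- The Toeplitz matrix of complete symmetric polynomials. -/
noncomputable def matH (σ : Type*) [Fintype σ] [DecidableEq σ] (N : ℕ) :
    Matrix (Fin N) (Fin N) (MvPolynomial σ ℤ) :=
  Matrix.of fun a b => hsymmZ σ ((a : ℤ) - b)

/-- The signed Toeplitz matrix of elementary symmetric polynomials. -/
noncomputable def matE (σ : Type*) [Fintype σ] [DecidableEq σ] (N : ℕ) :
    Matrix (Fin N) (Fin N) (MvPolynomial σ ℤ) :=
  Matrix.of fun a b => (-1) ^ ((a : ℕ) + b) * esymmZ σ ((a : ℤ) - b)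

lemma matH_mul_matE (σ : Type*) [Fintype σ] [DecidableEq σ] (N : ℕ) :
    matH σ N * matE σ N = 1 := by
  ext1 a b
  rw [Matrix.mul_apply, Matrix.one_apply]
  simp only [matH, matE, Matrix.of_apply]
  rw [Fin.sum_univ_eq_sum_range (fun c : ℕ => hsymmZ σ ((a : ℤ) - c) *
    ((-1) ^ (c + (b : ℕ)) * esymmZ σ ((c : ℤ) - b))) N]
  by_cases hab : (b : ℕ) ≤ a
  · obtain ⟨d, hd⟩ := Nat.exists_eq_add_of_le hab
    have h1 := sum_HE σ d
    have : (a = b) ↔ d = 0 := by rw [Fin.ext_iff]; omega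
    simp only [this]
    rw [← h1]
    symm
    refine Finset.sum_of_injOn (fun p => p.2 + (b : ℕ)) ?_ ?_ ?_ ?_
    · intro p hp q hq h
      simp only [Finset.mem_coe,
        Finset.HasAntidiagonal.mem_antidiagonal] at hp hq h
      ext <;> omega
    · intro p hp
      simp only [Finset.mem_coe, Finset.HasAntidiagonal.mem_antidiagonal, Finset.mem_range] at hp ⊢
      have := a.2
      omega
    · intro c hc hc'
      by_cases hcb : c < b
      · rw [esymmZ_neg _ _ (by omega)]; simp
      by_cases hca : (a : ℕ) < c
      · rw [hsymmZ_neg _ _ (by omega)]; simp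
      exfalso
      apply hc'
      refine ⟨(a - c, c - b), ?_, ?_⟩
      · simp only [Finset.mem_coe, Finset.HasAntidiagonal.mem_antidiagonal]; omega
      · simp only; omega
    · intro p hp
      rw [Finset.HasAntidiagonal.mem_antidiagonal] at hp
      have e1 : ((a : ℕ) : ℤ) - ((p.2 + (b : ℕ) : ℕ) : ℤ) = (p.1 : ℤ) := by omega
      have e2 : ((p.2 + (b : ℕ) : ℕ) : ℤ) - ((b : ℕ) : ℤ) = (p.2 : ℤ) := by omega
      rw [e1, e2, hsymmZ_natCast, esymmZ_natCast]
      congr 2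
      rw [add_assoc, pow_add, ← two_mul, pow_mul]; simp
  · rw [if_neg (by rintro rfl; exact hab le_rfl)]
    refine Finset.sum_eq_zero fun c _ => ?_
    by_cases hcb : c < b
    · rw [esymmZ_neg _ _ (by omega)]; simp
    · rw [hsymmZ_neg _ _ (by omega)]; simp

lemma det_matH (σ : Type*) [Fintype σ] [DecidableEq σ] (N : ℕ) :
    (matH σ N).det = 1 := by
  rw [Matrix.det_of_isLowerTriangular]
  · refine Finset.prod_eq_one fun i _ => ?_
    simp [matH, hsymmZ]
  · intro i j hij
    have : (i : ℕ) < j := by simpa using hij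
    exact hsymmZ_neg _ _ (by omega)

/-- Jacobi's complementary minor identity. -/
lemma jacobi_minor {R : Type*} [CommRing R] {m n N : Type*} [Fintype m] [Fintype n] [Fintype N]
    [DecidableEq m] [DecidableEq n] [DecidableEq N] (A B : Matrix N N R) (hAB : A * B = 1)
    (hA : A.det = 1) (e f : m ⊕ n ≃ N) :
    (A.submatrix (fun i => e (Sum.inl i)) (fun i => f (Sum.inl i))).det =
      ((Equiv.Perm.sign (e.trans f.symm) : ℤˣ) : ℤ) *
      (B.submatrix (fun i => f (Sum.inr i)) (fun i => e (Sum.inr i))).det := by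
  set A' := A.submatrix e f with hA'
  set B' := B.submatrix f e with hB'
  have hm : A' * B' = 1 := by
    rw [hA', hB', Matrix.submatrix_mul_equiv, hAB, Matrix.submatrix_one_equiv]
  have hd : A'.det = ((Equiv.Perm.sign (e.trans f.symm) : ℤˣ) : ℤ) := by
    have : A' = (A.submatrix f f).submatrix (e.trans f.symm) id := by
      ext; simp [hA']
    rw [this, Matrix.det_permute, Matrix.det_submatrix_equiv_self, hA, mul_one]
  have h1 : A' * Matrix.fromBlocks 1 B'.toBlocks₁₂ 0 B'.toBlocks₂₂ =
      Matrix.fromBlocks A'.toBlocks₁₁ 0 A'.toBlocks₂₁ 1 := by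
    have hm' := hm
    rw [← Matrix.fromBlocks_toBlocks A', ← Matrix.fromBlocks_toBlocks B',
      Matrix.fromBlocks_multiply, ← Matrix.fromBlocks_one, Matrix.fromBlocks_inj] at hm'
    conv_lhs => rw [← Matrix.fromBlocks_toBlocks A']
    rw [Matrix.fromBlocks_multiply, hm'.2.1, hm'.2.2.2]
    simp
  have h2 := congrArg Matrix.det h1
  rw [Matrix.det_mul, Matrix.det_fromBlocks_zero₂₁, Matrix.det_fromBlocks_zero₁₂, hd] at h2
  simp only [Matrix.det_one, one_mul, mul_one] at h2
  exact h2.symm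

lemma lt_conjPart_iff (lam : ℕ → ℕ) (hlam : Antitone lam) (l : ℕ)
    (hl : ∀ i, l ≤ i → lam i = 0) (i j : ℕ) : i < conjPart lam j ↔ j < lam i := by
  have hex : ∃ i, lam i ≤ j := ⟨l, by rw [hl l le_rfl]; exact Nat.zero_le _⟩
  have hset : {i : ℕ | j < lam i} = Set.Iio (Nat.find hex) := by
    ext k
    simp only [Set.mem_setOf_eq, Set.mem_Iio, Nat.lt_find_iff, not_le]
    exact ⟨fun h m hm => lt_of_lt_of_le h (hlam hm), fun h => h k le_rfl⟩
  have hc : conjPart lam j = Nat.find hex := by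
    unfold conjPart
    rw [hset]
    simp
  rw [hc]
  exact (Set.ext_iff.mp hset i).symm

/-- `a` and `b` are conjugate partitions, `a` with at most `l` and `b` with at most `l'` parts. -/
structure IsConj' (l l' : ℕ) (a b : ℕ → ℕ) : Prop where
  iff : ∀ i j, i < b j ↔ j < a i
  ha : ∀ i, l ≤ i → a i = 0
  hb : ∀ j, l' ≤ j → b j = 0

namespace IsConj'

variable {l l' : ℕ} {a b : ℕ → ℕ}

lemma antiA (h : IsConj' l l' a b) {i k : ℕ} (hik : i ≤ k) : a k ≤ a i := by
  by_contra hc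
  push Not at hc
  have := (h.iff k (a i)).2 hc
  have := (h.iff i (a i)).1 (by omega)
  omega

lemma antiB (h : IsConj' l l' a b) {i k : ℕ} (hik : i ≤ k) : b k ≤ b i := by
  by_contra hc
  push Not at hc
  have := (h.iff (b i) k).1 hc
  have := (h.iff (b i) i).2 (by omega)
  omega

lemma leA (h : IsConj' l l' a b) (i : ℕ) : a i ≤ l' := by
  by_contra hc
  push Not at hc
  have := (h.iff i l').2 hc
  have := h.hb l' le_rfl
  omega

lemma leB (h : IsConj' l l' a b) (i : ℕ) : b i ≤ l := by
  by_contra hc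
  push Not at hc
  have := (h.iff l i).1 hc
  have := h.ha l le_rfl
  omega

/-- The indexing map. -/
def fn (h : IsConj' l l' a b) : Fin l ⊕ Fin l' → Fin (l + l')
  | Sum.inl i => ⟨a i + (l - 1 - i), by have := h.leA i; have := i.2; omega⟩
  | Sum.inr j => ⟨l + j - b j, by have := j.2; omega⟩

lemma fn_inj (h : IsConj' l l' a b) : Function.Injective h.fn := by
  rintro (i | i) (j | j) hij
  · rw [Fin.ext_iff] at hij
    simp only [fn] at hij
    congr 1
    ext
    have := i.2
    have := j.2
    rcases lt_trichotomy (i : ℕ) j with hh | hh | hh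
    · have := h.antiA hh.le; omega
    · exact hh
    · have := h.antiA hh.le; omega
  · exfalso
    rw [Fin.ext_iff] at hij
    simp only [fn] at hij
    have := h.iff i j
    have := h.leB j
    have := i.2
    omega
  · exfalso
    rw [Fin.ext_iff] at hij
    simp only [fn] at hij
    have := h.iff j i
    have := h.leB i
    have := j.2
    omega
  · rw [Fin.ext_iff] at hij
    simp only [fn] at hij
    congr 1
    ext
    have := h.leB i
    have := h.leB j
    rcases lt_trichotomy (i : ℕ) j with hh | hh | hh
    · have := h.antiB hh.le; omega
    · exact hh
    · have := h.antiB hh.le; omega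

/-- The indexing bijection. -/
noncomputable def eqv (h : IsConj' l l' a b) : Fin l ⊕ Fin l' ≃ Fin (l + l') :=
  Equiv.ofBijective h.fn ((Fintype.bijective_iff_injective_and_card _).2 ⟨h.fn_inj, by simp⟩)

lemma eqv_inl (h : IsConj' l l' a b) (i : Fin l) :
    (h.eqv (Sum.inl i) : ℕ) = a i + (l - 1 - i) := rfl

lemma eqv_inr (h : IsConj' l l' a b) (j : Fin l') :
    (h.eqv (Sum.inr j) : ℕ) = l + j - b j := rfl

lemma zero (l l' : ℕ) : IsConj' l l' (fun _ => 0) (fun _ => 0) := ⟨by simp, by simp, by simp⟩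

lemma sign_eqv (n : ℕ) : ∀ (a b : ℕ → ℕ) (h : IsConj' l l' a b), ∑ j : Fin l', b j = n →
    Equiv.Perm.sign (h.eqv.trans (zero l l').eqv.symm) = (-1) ^ n := by
  induction n with
  | zero =>
    intro a b h hs
    have hb0 : ∀ j, b j = 0 := by
      intro j
      by_cases hj : j < l'
      · simpa using (Finset.sum_eq_zero_iff.1 hs) ⟨j, hj⟩ (Finset.mem_univ _)
      · exact h.hb j (by omega)
    have ha0 : ∀ i, a i = 0 := by
      intro i
      by_contra hc
      have := (h.iff i 0).2 (by omega)
      have := hb0 0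
      omega
    have : h.eqv = (zero l l').eqv := by
      ext x
      rcases x with i | j
      · rw [eqv_inl, eqv_inl, ha0]
      · rw [eqv_inr, eqv_inr, hb0]
    rw [this]
    simp
  | succ n ih =>
    intro a b h hs
    have hpos : 0 < a 0 := by
      by_contra hc
      have : ∑ j : Fin l', b j = 0 := by
        refine Finset.sum_eq_zero fun j _ => ?_
        have := h.iff 0 j
        omega
      omega
    obtain ⟨j0, hj0⟩ : ∃ j0, a 0 = j0 + 1 := ⟨a 0 - 1, by omega⟩
    have hbj0 : 0 < b j0 := (h.iff 0 j0).2 (by omega)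
    obtain ⟨i0, hi0⟩ : ∃ i0, b j0 = i0 + 1 := ⟨b j0 - 1, by omega⟩
    have hai0 : a i0 = j0 + 1 := by
      have h1 := (h.iff i0 j0).1 (by omega)
      have h2 := h.antiA (Nat.zero_le i0)
      omega
    have hi0l : i0 < l := by have := h.leB j0; omega
    have hj0l : j0 < l' := by have := h.leA 0; omega
    have h' : IsConj' l l' (Function.update a i0 j0) (Function.update b j0 i0) := by
      refine ⟨?_, ?_, ?_⟩
      · intro i j
        have h1 := h.iff i j
        by_cases hi : i = i0 <;> by_cases hj : j = j0
        · subst hi hj; simp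
        · subst hi
          rw [Function.update_of_ne hj, Function.update_self]
          omega
        · subst hj
          rw [Function.update_of_ne hi, Function.update_self]
          omega
        · rw [Function.update_of_ne hi, Function.update_of_ne hj]
          exact h1
      · intro i hi
        rw [Function.update_of_ne (by omega)]
        exact h.ha i hi
      · intro j hj
        rw [Function.update_of_ne (by omega)]
        exact h.hb j hj
    have hsum : ∑ j : Fin l', Function.update b j0 i0 j = n := by
      have e1 := Finset.add_sum_erase Finset.univ (fun j : Fin l' => b j)
        (Finset.mem_univ ⟨j0, hj0l⟩)
      have e2 := Finset.add_sum_erase Finset.univ (fun j : Fin l' => Function.update b j0 i0 j)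
        (Finset.mem_univ ⟨j0, hj0l⟩)
      have e3 : ∑ j ∈ Finset.univ.erase (⟨j0, hj0l⟩ : Fin l'), Function.update b j0 i0 j =
          ∑ j ∈ Finset.univ.erase (⟨j0, hj0l⟩ : Fin l'), b j := by
        refine Finset.sum_congr rfl fun j hj => ?_
        rw [Function.update_of_ne]
        intro hc
        exact (Finset.ne_of_mem_erase hj) (Fin.ext hc)
      simp only [Function.update_self] at e1 e2
      omega
    have hE : h.eqv = (Equiv.swap (Sum.inl ⟨i0, hi0l⟩) (Sum.inr ⟨j0, hj0l⟩)).trans h'.eqv := by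
      ext x
      rw [Equiv.trans_apply]
      rcases x with i | j
      · by_cases hi : i = ⟨i0, hi0l⟩
        · subst hi
          rw [Equiv.swap_apply_left, eqv_inl, eqv_inr]
          simp only [Function.update_self]
          omega
        · rw [Equiv.swap_apply_of_ne_of_ne (by simpa using hi) (by simp), eqv_inl, eqv_inl,
            Function.update_of_ne]
          intro hc
          exact hi (Fin.ext hc)
      · by_cases hj : j = ⟨j0, hj0l⟩
        · subst hj
          rw [Equiv.swap_apply_right, eqv_inl, eqv_inr]
          simp only [Function.update_self]
          omega
        · rw [Equiv.swap_apply_of_ne_of_ne (by simp) (by simpa using hj), eqv_inr, eqv_inr,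
            Function.update_of_ne]
          intro hc
          exact hj (Fin.ext hc)
    rw [hE, Equiv.trans_assoc, Equiv.Perm.sign_trans, ih _ _ h' hsum,
      Equiv.Perm.sign_swap (by simp), pow_succ]

lemma sign_eqv_eqv {c d : ℕ → ℕ} (h : IsConj' l l' a b) (h2 : IsConj' l l' c d) :
    Equiv.Perm.sign (h.eqv.trans h2.eqv.symm) =
      (-1) ^ (∑ j : Fin l', b j) * (-1) ^ (∑ j : Fin l', d j) := by
  have : h.eqv.trans h2.eqv.symm = (h.eqv.trans (zero l l').eqv.symm).trans
      (h2.eqv.trans (zero l l').eqv.symm).symm := by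
    ext x; simp
  rw [this, Equiv.Perm.sign_trans, Equiv.Perm.sign_symm, sign_eqv _ _ _ h rfl,
    sign_eqv _ _ _ h2 rfl, mul_comm]

lemma prod_sign {R : Type*} [CommRing R] (h : IsConj' l l' a b) :
    (∏ j : Fin l', (-1 : R) ^ (l + (j : ℕ) - b j)) =
      (∏ j : Fin l', (-1 : R) ^ (l + (j : ℕ))) * (-1) ^ (∑ j : Fin l', b j) := by
  rw [← Finset.prod_pow_eq_pow_sum, ← Finset.prod_mul_distrib]
  refine Finset.prod_congr rfl fun j _ => ?_
  have h1 := h.leB j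
  obtain ⟨k, hk⟩ := Nat.exists_eq_add_of_le (show b j ≤ l + (j : ℕ) by omega)
  rw [hk, Nat.add_sub_cancel_left, pow_add, mul_right_comm, ← mul_pow]
  simp

lemma duality (σ : Type*) [Fintype σ] [DecidableEq σ] {c d : ℕ → ℕ} (h : IsConj' l l' a b)
    (h2 : IsConj' l l' c d) :
    Matrix.det (Matrix.of fun i j : Fin l => hsymmZ σ ((a i : ℤ) - c j - i + j)) =
    Matrix.det (Matrix.of fun i j : Fin l' => esymmZ σ ((b i : ℤ) - d j - i + j)) := by
  have hJ := jacobi_minor (matH σ (l + l')) (matE σ (l + l')) (matH_mul_matE σ _)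
    (det_matH σ _) h.eqv h2.eqv
  have e1 : (matH σ (l + l')).submatrix (fun i => h.eqv (Sum.inl i))
      (fun i => h2.eqv (Sum.inl i)) =
      Matrix.of fun i j : Fin l => hsymmZ σ ((a i : ℤ) - c j - i + j) := by
    ext1 i j
    simp only [matH, Matrix.submatrix_apply, Matrix.of_apply, eqv_inl]
    congr 1
    have := i.2
    have := j.2
    omega
  have e2 : (matE σ (l + l')).submatrix (fun i => h2.eqv (Sum.inr i))
      (fun i => h.eqv (Sum.inr i)) =
      Matrix.of fun i j : Fin l' => (-1) ^ (l + (i : ℕ) - d i) *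
        (Matrix.of fun i j : Fin l' => (-1) ^ (l + (j : ℕ) - b j) *
          (Matrix.of fun i j : Fin l' => esymmZ σ ((b i : ℤ) - d j - i + j)).transpose i j) i j := by
    ext1 i j
    simp only [matE, Matrix.submatrix_apply, Matrix.of_apply, eqv_inr, Matrix.transpose_apply,
      pow_add, mul_assoc]
    congr 3
    have := h.leB j
    have := h2.leB i
    omega
  rw [e1, e2, Matrix.det_mul_column, Matrix.det_mul_row, Matrix.det_transpose, sign_eqv_eqv,
    prod_sign h, prod_sign h2] at hJ
  rw [hJ]
  push_cast
  set P := ∏ j : Fin l', (-1 : MvPolynomial σ ℤ) ^ (l + (j : ℕ))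
  have hP : P * P = 1 := by
    rw [← Finset.prod_mul_distrib]
    refine Finset.prod_eq_one fun j _ => ?_
    rw [← mul_pow]; simp
  have hs : ∀ n : ℕ, (-1 : MvPolynomial σ ℤ) ^ n * (-1) ^ n = 1 := by
    intro n; rw [← mul_pow]; simp
  have hb := hs (∑ j : Fin l', b j)
  have hd := hs (∑ j : Fin l', d j)
  set u := (-1 : MvPolynomial σ ℤ) ^ (∑ j : Fin l', b j)
  set v := (-1 : MvPolynomial σ ℤ) ^ (∑ j : Fin l', d j)
  set D := Matrix.det (Matrix.of fun i j : Fin l' => esymmZ σ ((b i : ℤ) - d j - i + j))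
  calc u * v * (P * v * (P * u * D)) = (u * u) * (v * v) * (P * P) * D := by ring
    _ = D := by rw [hb, hd, hP]; ring

end IsConj'

theorem skew_jacobi_trudi_duality
    (σ : Type*) [Fintype σ] [DecidableEq σ]
    (lam mu : ℕ → ℕ) (hlam : Antitone lam) (hmu : Antitone mu)
    (hsub : ∀ i, mu i ≤ lam i)
    (l l' : ℕ)
    (hl : ∀ i, l ≤ i → lam i = 0)
    (hl' : ∀ i, l' ≤ i → conjPart lam i = 0) :
    Matrix.det (Matrix.of fun i j : Fin l =>
        hsymmZ σ ((lam i : ℤ) - mu j - i + j)) =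
    Matrix.det (Matrix.of fun i j : Fin l' =>
        esymmZ σ ((conjPart lam i : ℤ) - conjPart mu j - i + j)) := by
  have h1 := lt_conjPart_iff lam hlam l hl
  have hmu0 : ∀ i, l ≤ i → mu i = 0 := fun i hi => by
    have := hsub i
    have := hl i hi
    omega
  have h2 := lt_conjPart_iff mu hmu l hmu0
  have H1 : IsConj' l l' lam (conjPart lam) := ⟨h1, hl, hl'⟩
  have H2 : IsConj' l l' mu (conjPart mu) := ⟨h2, hmu0, fun j hj => by
    have := hl' j hj
    have := h1 0 j
    have := h2 0 j
    have := hsub 0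
    omega⟩
  exact H1.duality σ H2
end
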